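/- arXiv:1306.5464 — 8 statements merged into one kernel-verified Lean document; each statement's English description precedes it below -/
import Mathlib

section
/- Let st be a statistic satisfying properties (1) and (2), and let X_n be the set of st-restricted growth sequences of length n. If s and t are sequences in X_n such that t is the successor of s in X_n with respect to the Reflected Gray Code order ≺, and k is the leftmost position where s and t differ, then t_k = s_k + 1 or t_k = s_k − 1. -/
/-- Ascent statistic of the prefix `s 1, …, s k` (sequences are 1-indexed). -/
def ascStat (s : ℕ → ℕ) (k : ℕ) : ℕ :=
  ((Finset.Ico 1 k).filter (fun i => s i < s (i + 1))).card

/-- Maximum statistic of the prefix `s 1, …, s k`. -/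
def maxStat (s : ℕ → ℕ) (k : ℕ) : ℕ :=
  (Finset.Icc 1 k).sup s

/-- Length statistic of the prefix `s 1, …, s k` (its length minus one). -/
def lenStat (_ : ℕ → ℕ) (k : ℕ) : ℕ := k - 1

/-- Last-value statistic of the prefix `s 1, …, s k`. -/
def lvStat (s : ℕ → ℕ) (k : ℕ) : ℕ := s k

/-- Subexcedant sequences of length `n` (positions `1,…,n`). -/
def memSE (n : ℕ) (s : ℕ → ℕ) : Prop :=
  s 1 = 0 ∧ ∀ k, 1 ≤ k → k < n → s (k + 1) ≤ k

/-- Ascent sequences of length `n`. -/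
def memA (n : ℕ) (s : ℕ → ℕ) : Prop :=
  s 1 = 0 ∧ ∀ k, 1 ≤ k → k < n → s (k + 1) ≤ ascStat s k + 1

/-- Restricted growth functions of length `n`. -/
def memR (n : ℕ) (s : ℕ → ℕ) : Prop :=
  s 1 = 0 ∧ ∀ k, 1 ≤ k → k < n → s (k + 1) ≤ maxStat s k + 1

/-- Staircase words of length `n`. -/
def memS (n : ℕ) (s : ℕ → ℕ) : Prop :=
  s 1 = 0 ∧ ∀ k, 1 ≤ k → k < n → s (k + 1) ≤ s k + 1

/-- The Reflected Gray Code order `≺` on length-`n` sequences: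
at the leftmost position `k` where `s` and `t` differ, either the sum of the
first `k-1` entries of `s` is even and `s k < t k`, or it is odd and `s k > t k`. -/
def rgcLt (n : ℕ) (s t : ℕ → ℕ) : Prop :=
  ∃ k, 1 ≤ k ∧ k ≤ n ∧ (∀ i, 1 ≤ i → i < k → s i = t i) ∧ s k ≠ t k ∧
    ((Even (∑ i ∈ Finset.Ico 1 k, s i) ∧ s k < t k) ∨
     (¬ Even (∑ i ∈ Finset.Ico 1 k, s i) ∧ t k < s k))

/-- The Co-Reflected Gray Code order `≺_c` on length-`n` sequences:
at the rightmost position `k` where `s` and `t` differ, either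
`(∑_{i=k+1}^{n} s i) + (n-k)` is even and `s k > t k`, or it is odd and `s k < t k`. -/
def corgcLt (n : ℕ) (s t : ℕ → ℕ) : Prop :=
  ∃ k, 1 ≤ k ∧ k ≤ n ∧ (∀ i, k < i → i ≤ n → s i = t i) ∧ s k ≠ t k ∧
    ((Even ((∑ i ∈ Finset.Ioc k n, s i) + (n - k)) ∧ t k < s k) ∨
     (¬ Even ((∑ i ∈ Finset.Ioc k n, s i) + (n - k)) ∧ s k < t k))

/-- `t` is the successor of `s` in the set `X` with respect to the order `lt`. -/
def IsSuccessor (X : (ℕ → ℕ) → Prop) (lt : (ℕ → ℕ) → (ℕ → ℕ) → Prop)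
    (s t : ℕ → ℕ) : Prop :=
  X s ∧ X t ∧ lt s t ∧ ¬ ∃ u, X u ∧ lt s u ∧ lt u t

/-- `b` (read at positions `k+1,…,n`) is an admissible suffix in `X`. -/
def AdmissibleSuffix (X : (ℕ → ℕ) → Prop) (n k : ℕ) (b : ℕ → ℕ) : Prop :=
  ∃ s, X s ∧ ∀ i, k < i → i ≤ n → s i = b i

/-- `α_X(b)`: the set of values `x` such that `x b_{k+1} … b_n` is an admissible
suffix in `X` (occupying positions `k,…,n`). -/
def alphaSet (X : (ℕ → ℕ) → Prop) (n k : ℕ) (b : ℕ → ℕ) : Set ℕ :=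
  {x | ∃ s, X s ∧ s k = x ∧ ∀ i, k < i → i ≤ n → s i = b i}

/-- `μ_X(b)`: the minimum value of the statistic `st` on the length-`(k+1)` prefix
`s_1 … s_k b_{k+1}` over all sequences `s` in `X` having suffix `b` at positions
`k+1,…,n`. -/
noncomputable def muVal (X : (ℕ → ℕ) → Prop) (st : (ℕ → ℕ) → ℕ → ℕ) (n k : ℕ) (b : ℕ → ℕ) : ℕ :=
  sInf {v | ∃ s, X s ∧ (∀ i, k < i → i ≤ n → s i = b i) ∧ st s (k + 1) = v}

/-- The sequence agreeing with `s` before position `k`, equal to `v` at `k` and `0` afterwards. -/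
def prefixThenZero (s : ℕ → ℕ) (k v i : ℕ) : ℕ :=
  if i < k then s i else if i = k then v else 0

/-- For an `st`-restricted growth statistic satisfying properties (1)
and (2), if `t` is the successor of `s` in `X_n` with respect to the RGC order and
`k` is the leftmost position where `s` and `t` differ, then `t k = s k + 1` or
`s k = t k + 1`. -/
theorem succ_rgc_differs_by_one
    (n : ℕ) (st : (ℕ → ℕ) → ℕ → ℕ)
    (hext : ∀ s t : ℕ → ℕ, ∀ k, (∀ i, 1 ≤ i → i ≤ k → s i = t i) → st s k = st t k)
    (h1 : ∀ s : ℕ → ℕ, ∀ k, 1 ≤ k → st s k ≤ k - 1)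
    (h2 : ∀ s : ℕ → ℕ, ∀ k, 2 ≤ k → s k = st s (k - 1) + 1 → st s k = s k)
    (X : (ℕ → ℕ) → Prop)
    (hX : ∀ s, X s ↔ (s 1 = 0 ∧ ∀ k, 1 ≤ k → k < n → s (k + 1) ≤ st s k + 1))
    (s t : ℕ → ℕ) (hsucc : IsSuccessor X (rgcLt n) s t)
    (k : ℕ) (hk1 : 1 ≤ k) (hkn : k ≤ n)
    (heq : ∀ i, 1 ≤ i → i < k → s i = t i) (hne : s k ≠ t k) :
    t k = s k + 1 ∨ s k = t k + 1 := by
  obtain ⟨hXs, hXt, ⟨j, hj1, hjn, hjeq, hjne, hpar⟩, hno⟩ := hsucc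
  obtain rfl : j = k := by
    rcases lt_trichotomy j k with h | h | h
    · exact absurd (heq j hj1 h) hjne
    · exact h
    · exact absurd (hjeq k hk1 h) hne
  rw [hX] at hXs hXt
  have hj2 : j ≠ 1 := by
    rintro rfl
    exact hne (hXs.1.trans hXt.1.symm)
  by_contra hcon
  obtain ⟨v, hv⟩ : ∃ v, (s j < v ∧ v < t j) ∨ (t j < v ∧ v < s j) := by
    rcases lt_or_gt_of_ne hne with h | h
    · exact ⟨s j + 1, by omega⟩
    · exact ⟨t j + 1, by omega⟩
  have hu : ∀ i, i < j → prefixThenZero s j v i = s i := fun i hi => by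
    simp [prefixThenZero, hi]
  have huj : prefixThenZero s j v j = v := by simp [prefixThenZero]
  have hsum : ∑ i ∈ Finset.Ico 1 j, prefixThenZero s j v i = ∑ i ∈ Finset.Ico 1 j, s i :=
    Finset.sum_congr rfl fun i hi => hu i (Finset.mem_Ico.mp hi).2
  refine hno ⟨prefixThenZero s j v, (hX _).2 ⟨?_, fun m hm1 hmn => ?_⟩,
    ⟨j, hj1, hjn, fun i _ hi => (hu i hi).symm, ?_, ?_⟩,
    ⟨j, hj1, hjn, fun i hi1 hi => (hu i hi).trans (heq i hi1 hi), ?_, ?_⟩⟩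
  · rw [hu 1 (by omega), hXs.1]
  · rcases lt_trichotomy (m + 1) j with h | h | h
    · rw [hu _ h, hext _ s m fun i _ hi => hu i (by omega)]
      exact hXs.2 m hm1 hmn
    · have hs := hXs.2 m hm1 hmn
      have ht := hXt.2 m hm1 hmn
      rw [← hext s t m fun i hi1 hi => heq i hi1 (by omega)] at ht
      rw [hext _ s m fun i _ hi => hu i (by omega), h, huj]
      rw [h] at hs ht
      omega
    · simp [prefixThenZero, h.not_gt, h.ne']
  · omega
  · rw [huj]
    exact hpar.imp (fun h => ⟨h.1, by omega⟩) (fun h => ⟨h.1, by omega⟩)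
  · omega
  · rw [huj, hsum]
    exact hpar.imp (fun h => ⟨h.1, by omega⟩) (fun h => ⟨h.1, by omega⟩)
end

section
/- Let X_n be one of the sets A_n (ascent sequences), R_n (restricted growth functions), or S_n (staircase words) of length n. If s and t are sequences in X_n such that t is the successor of s in X_n with respect to the Reflected Gray Code order ≺, then there exists a position k such that s_i = t_i for every index i not in {k, k+1, k+2}; that is, s and t differ in at most 3 positions and these positions are adjacent (the lists of A_n, R_n and S_n in ≺ order are 3-adjacent Gray codes). -/
/-- Sequences of length `n` whose entries are bounded by one more than a prefix statistic `st`. -/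
def memStat (st : (ℕ → ℕ) → ℕ → ℕ) (n : ℕ) (s : ℕ → ℕ) : Prop :=
  s 1 = 0 ∧ ∀ k, 1 ≤ k → k < n → s (k + 1) ≤ st s k + 1

/-- The statistic `st` only depends on the prefix that it is evaluated on. -/
def IsPrefixStat (st : (ℕ → ℕ) → ℕ → ℕ) : Prop :=
  ∀ s t k, 1 ≤ k → (∀ i, 1 ≤ i → i ≤ k → s i = t i) → st s k = st t k

/-- Appending the largest admissible value increases the statistic by exactly one. -/
def GrowsByOne (st : (ℕ → ℕ) → ℕ → ℕ) (n : ℕ) : Prop :=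
  ∀ s, memStat st n s → ∀ k, 1 ≤ k → k < n → s (k + 1) = st s k + 1 →
    st s (k + 1) = st s k + 1

/-- The prefix of `w` before position `j`, followed by `v` and then by zeros. -/
def cutAt (w : ℕ → ℕ) (j v : ℕ) (i : ℕ) : ℕ :=
  if i < j then w i else if i = j then v else 0

lemma cutAt_of_lt (w : ℕ → ℕ) {j i : ℕ} (v : ℕ) (h : i < j) : cutAt w j v i = w i :=
  if_pos h

lemma cutAt_self (w : ℕ → ℕ) (j v : ℕ) : cutAt w j v j = v := by
  simp [cutAt]

lemma memStat_cutAt {st : (ℕ → ℕ) → ℕ → ℕ} (hst : IsPrefixStat st) {n : ℕ} {w : ℕ → ℕ}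
    (hw : memStat st n w) {j v : ℕ} (hj : 1 ≤ j) (hv : v ≤ st w j + 1) :
    memStat st n (cutAt w (j + 1) v) := by
  refine ⟨by rw [cutAt_of_lt w v (by omega)]; exact hw.1, fun i hi hin => ?_⟩
  have hpre : i ≤ j → st (cutAt w (j + 1) v) i = st w i := fun hij =>
    hst _ _ _ hi fun l _ hl => cutAt_of_lt w v (by omega)
  rcases lt_trichotomy i j with h | rfl | h
  · rw [cutAt_of_lt w v (by omega), hpre h.le]
    exact hw.2 i hi hin
  · rw [cutAt_self, hpre le_rfl]
    exact hv
  · simp [cutAt, show ¬ i + 1 < j + 1 by omega, show i ≠ j by omega]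

/-- Moving from `w` to `u` goes up in the order `≺` if `b` is even, and down if `b` is odd;
the first difference is located at position `j`. -/
def Moves (b j : ℕ) (w u : ℕ → ℕ) : Prop :=
  (∀ i, 1 ≤ i → i < j → w i = u i) ∧
    ((Even (b + ∑ i ∈ Finset.Ico 1 j, w i) ∧ w j < u j) ∨
     (¬ Even (b + ∑ i ∈ Finset.Ico 1 j, w i) ∧ u j < w j))

lemma sum_Ico_one_congr {w u : ℕ → ℕ} {j : ℕ} (h : ∀ i, 1 ≤ i → i < j → w i = u i) :
    ∑ i ∈ Finset.Ico 1 j, w i = ∑ i ∈ Finset.Ico 1 j, u i :=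
  Finset.sum_congr rfl fun i hi => by
    rw [Finset.mem_Ico] at hi
    exact h i hi.1 hi.2

lemma Moves.rgcLt {n j : ℕ} {w u : ℕ → ℕ} (h : Moves 0 j w u) (hj : 1 ≤ j) (hjn : j ≤ n) :
    rgcLt n w u := by
  obtain ⟨h1, h2⟩ := h
  rw [zero_add] at h2
  exact ⟨j, hj, hjn, h1, by omega, h2⟩

lemma Moves.rgcLt_swap {n j : ℕ} {w u : ℕ → ℕ} (h : Moves 1 j w u) (hj : 1 ≤ j)
    (hjn : j ≤ n) : _root_.rgcLt n u w := by
  obtain ⟨h1, h2⟩ := h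
  rw [sum_Ico_one_congr h1, Nat.even_add] at h2
  refine ⟨j, hj, hjn, fun i hi hij => (h1 i hi hij).symm, by omega, ?_⟩
  simp only [Nat.not_even_one, false_iff] at h2
  tauto

/-- A word that is extremal among the words with the same first `k` letters vanishes beyond
position `k + 2`. -/
lemma eq_zero_of_extremal {st : (ℕ → ℕ) → ℕ → ℕ} {n : ℕ} (hst : IsPrefixStat st)
    (hgrow : GrowsByOne st n) {w : ℕ → ℕ} (hw : memStat st n w) {b k : ℕ} (hk : 1 ≤ k)
    (hext : ∀ u j, memStat st n u → k < j → j ≤ n → ¬ Moves b j w u) :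
    ∀ i, k + 2 < i → i ≤ n → w i = 0 := by
  set P : ℕ → ℕ := fun j => b + ∑ i ∈ Finset.Ico 1 j, w i with hP
  have hstep : ∀ j, 1 ≤ j → P (j + 1) = P j + w j := fun j hj => by
    simp only [hP, Finset.sum_Ico_succ_top hj, add_assoc]
  have hodd : ∀ j, k < j → j ≤ n → ¬ Even (P j) → w j = 0 := by
    intro j hj hjn hp
    by_contra h0
    obtain ⟨m, rfl⟩ : ∃ m, j = m + 1 := ⟨j - 1, by omega⟩
    refine hext (cutAt w (m + 1) 0) (m + 1)
      (memStat_cutAt hst hw (by omega) (Nat.zero_le _)) hj hjn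
      ⟨fun i _ hi => (cutAt_of_lt w 0 hi).symm, Or.inr ⟨hp, ?_⟩⟩
    rw [cutAt_self]
    omega
  have heven : ∀ j, k ≤ j → j < n → Even (P (j + 1)) → w (j + 1) = st w j + 1 := by
    intro j hj hjn hp
    by_contra h0
    have hle := hw.2 j (by omega) hjn
    refine hext (cutAt w (j + 1) (st w j + 1)) (j + 1)
      (memStat_cutAt hst hw (by omega) le_rfl) (by omega) (by omega)
      ⟨fun i _ hi => (cutAt_of_lt w _ hi).symm, Or.inl ⟨hp, ?_⟩⟩
    rw [cutAt_self]
    omega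
  have hstay : ∀ j, k < j → ¬ Even (P j) → ∀ i, j ≤ i → i ≤ n → ¬ Even (P i) := by
    intro j hj hp i hji
    induction i, hji using Nat.le_induction with
    | base => exact fun _ => hp
    | succ i hji ih =>
      intro hin
      have h := ih (by omega)
      rwa [hstep i (by omega), hodd i (by omega) (by omega) h, add_zero]
  intro i hi hin
  refine hodd i (by omega) hin ?_
  by_cases h1 : Even (P (k + 1))
  · by_cases h2 : Even (P (k + 2))
    · refine hstay (k + 3) (by omega) ?_ i (by omega) hin
      have e1 := heven k le_rfl (by omega) h1
      have e2 := heven (k + 1) (by omega) (by omega) h2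
      rw [hgrow w hw k hk (by omega) e1] at e2
      have s1 := hstep (k + 1) (by omega)
      have s2 := hstep (k + 2) (by omega)
      rw [Nat.even_iff] at *
      simp only [add_assoc, Nat.reduceAdd] at *
      omega
    · exact hstay (k + 2) (by omega) h2 i (by omega) hin
  · exact hstay (k + 1) (by omega) h1 i (by omega) hin

/-- Successive words differ only in the first position of difference and the two positions
following it. -/
lemma memStat_three_adjacent {st : (ℕ → ℕ) → ℕ → ℕ} {n : ℕ} (hst : IsPrefixStat st)
    (hgrow : GrowsByOne st n) {s t : ℕ → ℕ} (h : IsSuccessor (memStat st n) (rgcLt n) s t) :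
    ∃ k, ∀ i, 1 ≤ i → i ≤ n → i ≠ k → i ≠ k + 1 → i ≠ k + 2 → s i = t i := by
  obtain ⟨hs, ht, ⟨k, hk, hkn, hpre, hne, hlt⟩, hno⟩ := h
  have zs : ∀ i, k + 2 < i → i ≤ n → s i = 0 := by
    refine eq_zero_of_extremal hst hgrow hs (b := 0) hk fun u j hu hkj hjn hm => ?_
    refine hno ⟨u, hu, hm.rgcLt (by omega) hjn, k, hk, hkn, ?_⟩
    have hsu := hm.1
    rw [← hsu k hk hkj, ← sum_Ico_one_congr fun i hi hik => hsu i hi (by omega)]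
    exact ⟨fun i hi hik => by rw [← hsu i hi (by omega), hpre i hi hik], hne, hlt⟩
  have zt : ∀ i, k + 2 < i → i ≤ n → t i = 0 := by
    refine eq_zero_of_extremal hst hgrow ht (b := 1) hk fun u j hu hkj hjn hm => ?_
    refine hno ⟨u, hu, ⟨k, hk, hkn, ?_⟩, hm.rgcLt_swap (by omega) hjn⟩
    have htu := hm.1
    rw [← htu k hk hkj]
    exact ⟨fun i hi hik => by rw [← htu i hi (by omega), hpre i hi hik], hne, hlt⟩
  refine ⟨k, fun i hi hin h0 h1 h2 => ?_⟩
  rcases lt_or_ge i k with h | h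
  · exact hpre i hi h
  · rw [zs i (by omega) hin, zt i (by omega) hin]

lemma isPrefixStat_ascStat : IsPrefixStat ascStat := by
  intro s t k _ h
  refine congrArg Finset.card (Finset.filter_congr fun i hi => ?_)
  rw [Finset.mem_Ico] at hi
  rw [h i hi.1 hi.2.le, h (i + 1) (by omega) hi.2]

lemma isPrefixStat_maxStat : IsPrefixStat maxStat := by
  intro s t k _ h
  refine Finset.sup_congr rfl fun i hi => ?_
  rw [Finset.mem_Icc] at hi
  exact h i hi.1 hi.2

lemma isPrefixStat_lvStat : IsPrefixStat lvStat :=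
  fun _ _ k hk h => h k hk le_rfl

lemma ascStat_succ (s : ℕ → ℕ) {k : ℕ} (hk : 1 ≤ k) :
    ascStat s (k + 1) = ascStat s k + if s k < s (k + 1) then 1 else 0 := by
  unfold ascStat
  rw [← Finset.insert_Ico_right_eq_Ico_add_one hk, Finset.filter_insert]
  split_ifs with h
  · rw [Finset.card_insert_of_notMem (by simp)]
  · rfl

lemma le_ascStat {n : ℕ} {s : ℕ → ℕ} (hs : memStat ascStat n s) {k : ℕ} (hk : 1 ≤ k) :
    k ≤ n → s k ≤ ascStat s k := by
  induction k, hk using Nat.le_induction with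
  | base => simp [hs.1]
  | succ k hk ih =>
    intro hkn
    have h1 := ih (by omega)
    have h2 := hs.2 k hk hkn
    rw [ascStat_succ s hk]
    split_ifs <;> omega

lemma growsByOne_ascStat (n : ℕ) : GrowsByOne ascStat n := by
  intro s hs k hk hkn h
  have := le_ascStat hs hk hkn.le
  rw [ascStat_succ s hk, if_pos (by omega)]

lemma growsByOne_maxStat (n : ℕ) : GrowsByOne maxStat n := by
  intro s _ k _ _ h
  have hmax : maxStat s (k + 1) = s (k + 1) ⊔ maxStat s k := by
    unfold maxStat
    rw [← Finset.insert_Icc_right_eq_Icc_add_one (by omega), Finset.sup_insert]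
  rw [hmax, h]
  simp

lemma growsByOne_lvStat (n : ℕ) : GrowsByOne lvStat n :=
  fun _ _ _ _ _ h => h

/-- For `X_n` one of `A_n`, `R_n`, `S_n`, successive sequences in the
RGC order differ in at most 3 adjacent positions (3-adjacent Gray codes). -/
theorem rgc_three_adjacent_gray_code
    (n : ℕ) (X : (ℕ → ℕ) → Prop)
    (hX : X = memA n ∨ X = memR n ∨ X = memS n)
    (s t : ℕ → ℕ) (hsucc : IsSuccessor X (rgcLt n) s t) :
    ∃ k, ∀ i, 1 ≤ i → i ≤ n → i ≠ k → i ≠ k + 1 → i ≠ k + 2 → s i = t i := by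
  rcases hX with rfl | rfl | rfl
  · exact memStat_three_adjacent isPrefixStat_ascStat (growsByOne_ascStat n) hsucc
  · exact memStat_three_adjacent isPrefixStat_maxStat (growsByOne_maxStat n) hsucc
  · exact memStat_three_adjacent isPrefixStat_lvStat (growsByOne_lvStat n) hsucc
end

section
/- Let X_n be one of the sets A_n (ascent sequences), R_n (restricted growth functions), or S_n (staircase words) of length n, and let s = s_1…s_n ∈ X_n. If there is a k with 1 ≤ k < n such that s_{k+1} = k, then s_i = i − 1 for all i with 1 ≤ i ≤ k. -/
theorem ascStat_le (s : ℕ → ℕ) (k : ℕ) : ascStat s k ≤ k - 1 :=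
  (Finset.card_filter_le _ _).trans_eq (Nat.card_Ico 1 k)

theorem lt_succ_of_le_ascStat {s : ℕ → ℕ} {k i : ℕ} (h : k - 1 ≤ ascStat s k)
    (hi : 1 ≤ i) (hik : i < k) : s i < s (i + 1) := by
  have hcard : ascStat s k = (Finset.Ico 1 k).card :=
    (ascStat_le s k).antisymm h |>.trans (Nat.card_Ico 1 k).symm
  exact Finset.card_filter_eq_iff.mp hcard i (Finset.mem_Ico.mpr ⟨hi, hik⟩)

theorem memA.memSE {n : ℕ} {s : ℕ → ℕ} (h : memA n s) : memSE n s := by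
  refine ⟨h.1, fun k hk hkn => ?_⟩
  have h₁ := h.2 k hk hkn
  have h₂ := ascStat_le s k
  omega

theorem memS.memR {n : ℕ} {s : ℕ → ℕ} (h : memS n s) : memR n s := by
  refine ⟨h.1, fun k hk hkn => (h.2 k hk hkn).trans ?_⟩
  exact Nat.succ_le_succ (Finset.le_sup (f := s) (Finset.mem_Icc.mpr ⟨hk, le_rfl⟩))

theorem memSE.le_pred {n : ℕ} {s : ℕ → ℕ} (h : memSE n s) {i : ℕ} (hi : 1 ≤ i)
    (hin : i ≤ n) : s i ≤ i - 1 := by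
  obtain ⟨j, rfl⟩ := Nat.exists_eq_add_of_le' hi
  rcases Nat.eq_zero_or_pos j with rfl | hj
  · exact h.1.le
  · exact h.2 j hj hin

theorem memR.memSE {n : ℕ} {s : ℕ → ℕ} (h : memR n s) : memSE n s := by
  refine ⟨h.1, fun k => ?_⟩
  induction k using Nat.strong_induction_on with
  | _ k ih =>
    intro hk hkn
    have hle : maxStat s k ≤ k - 1 := Finset.sup_le fun i hi => by
      obtain ⟨hi, hik⟩ := Finset.mem_Icc.mp hi
      have hSE : _root_.memSE k s := ⟨h.1, fun j hj hjk => ih j hjk hj (hjk.trans hkn)⟩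
      have := hSE.le_pred hi hik
      omega
    have := h.2 k hk hkn
    omega

theorem memR.eq_pred_of_succ_eq {n : ℕ} {s : ℕ → ℕ} (h : memR n s) {k : ℕ} (hk : 1 ≤ k)
    (hkn : k < n) (hsk : s (k + 1) = k) : s k = k - 1 := by
  obtain ⟨i, hi, hmax⟩ := (Finset.Icc 1 k).exists_mem_eq_sup ⟨1, by simp [hk]⟩ s
  obtain ⟨hi, hik⟩ := Finset.mem_Icc.mp hi
  have hbound := h.2 k hk hkn
  rw [maxStat, hmax] at hbound
  have hi_le := h.memSE.le_pred hi (hik.trans hkn.le)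
  obtain rfl : i = k := by omega
  omega

theorem memR.eq_pred_of_value {n : ℕ} {s : ℕ → ℕ} (h : memR n s) {k : ℕ}
    (hkn : k < n) (hsk : s (k + 1) = k) {i : ℕ} (hi : 1 ≤ i) (hik : i ≤ k) :
    s i = i - 1 := by
  induction k with
  | zero => omega
  | succ k ih =>
    have hs := h.eq_pred_of_succ_eq (by omega) hkn hsk
    rcases hik.eq_or_lt with rfl | hlt
    · exact hs
    · exact ih (by omega) hs (by omega)

theorem memA.eq_pred_of_value {n : ℕ} {s : ℕ → ℕ} (h : memA n s) {k : ℕ}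
    (hkn : k < n) (hsk : s (k + 1) = k) {i : ℕ} (hi : 1 ≤ i) (hik : i ≤ k) :
    s i = i - 1 := by
  have hasc : k - 1 ≤ ascStat s k := by
    have := h.2 k (hi.trans hik) hkn
    omega
  have hge : i - 1 ≤ s i := by
    induction i, hi using Nat.le_induction with
    | base => exact Nat.zero_le _
    | succ j hj ih =>
      have := ih (by omega)
      have := lt_succ_of_le_ascStat hasc hj hik
      omega
  exact (h.memSE.le_pred hi (hik.trans hkn.le)).antisymm hge


/-- For `X_n` one of `A_n`, `R_n`, `S_n`, if `s ∈ X_n` and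
`s (k+1) = k` for some `1 ≤ k < n`, then `s i = i - 1` for all `1 ≤ i ≤ k`. -/
theorem value_k_forces_staircase_prefix
    (n : ℕ) (X : (ℕ → ℕ) → Prop)
    (hX : X = memA n ∨ X = memR n ∨ X = memS n)
    (s : ℕ → ℕ) (hs : X s)
    (k : ℕ) (hk1 : 1 ≤ k) (hkn : k < n) (hsk : s (k + 1) = k) :
    ∀ i, 1 ≤ i → i ≤ k → s i = i - 1 := by
  intro i hi hik
  rcases hX with rfl | rfl | rfl
  · exact memA.eq_pred_of_value hs hkn hsk hi hik
  · exact memR.eq_pred_of_value hs hkn hsk hi hik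
  · exact (memS.memR hs).eq_pred_of_value hkn hsk hi hik
end

section
/- Let Y_n be one of the sets A_n, R_n, or S_n, with defining statistic st (respectively asc, m, lv), and let b = b_{k+1} b_{k+2} … b_n, with 1 ≤ k < n, be an admissible suffix in Y_n. Then: (1) if b = b_n is a length-one admissible suffix, then μ_Y(b) = b_n; (2) μ_Y(b) = k if and only if b_{k+1} = k; and (3) if x ∈ α_Y(b) and x ≥ b_{k+1}, then μ_Y(xb) = max{x, μ_Y(b)}. -/
/-- Sequences of length `n` whose growth is bounded by the statistic `st`. -/
def GrowthSeq (st : (ℕ → ℕ) → ℕ → ℕ) (n : ℕ) (s : ℕ → ℕ) : Prop :=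
  s 1 = 0 ∧ ∀ k, 1 ≤ k → k < n → s (k + 1) ≤ st s k + 1

/-- The one-step behaviour shared by the ascent and the maximum statistics. -/
structure IsGrowthStat (st : (ℕ → ℕ) → ℕ → ℕ) : Prop where
  one : ∀ s, s 1 = 0 → st s 1 = 0
  mono : ∀ s k, 1 ≤ k → st s k ≤ st s (k + 1)
  le_succ : ∀ s k, 1 ≤ k → s (k + 1) ≤ st s k + 1 → st s (k + 1) ≤ st s k + 1
  eq_of_le : ∀ s k, 1 ≤ k → s k ≤ st s k → s (k + 1) ≤ s k → st s (k + 1) = st s k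
  eq_succ : ∀ s k, 1 ≤ k → s k ≤ st s k → s (k + 1) = st s k + 1 → st s (k + 1) = st s k + 1
  step_le_step : ∀ s t k, 1 ≤ k → s k = t k → s (k + 1) = t (k + 1) → st s k ≤ st t k →
    st s (k + 1) ≤ st t (k + 1)

lemma maxStat_succ (s : ℕ → ℕ) (k : ℕ) :
    maxStat s (k + 1) = max (maxStat s k) (s (k + 1)) := by
  unfold maxStat
  rw [← Finset.insert_Icc_right_eq_Icc_add_one (by omega), Finset.sup_insert, sup_comm]

lemma isGrowthStat_ascStat : IsGrowthStat ascStat where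
  one s _ := by simp [ascStat]
  mono s k hk := by rw [ascStat_succ s hk]; omega
  le_succ s k hk _ := by rw [ascStat_succ s hk]; split_ifs <;> omega
  eq_of_le s k hk _ _ := by rw [ascStat_succ s hk, if_neg (by omega)]; rfl
  eq_succ s k hk _ _ := by rw [ascStat_succ s hk, if_pos (by omega)]
  step_le_step s t k hk h1 h2 _ := by rw [ascStat_succ s hk, ascStat_succ t hk, h1, h2]; omega

lemma isGrowthStat_maxStat : IsGrowthStat maxStat where
  one s hs := by simp [maxStat, hs]
  mono s k _ := by rw [maxStat_succ]; omega
  le_succ s k _ _ := by rw [maxStat_succ]; omega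
  eq_of_le s k _ _ _ := by rw [maxStat_succ]; omega
  eq_succ s k _ _ _ := by rw [maxStat_succ]; omega
  step_le_step s t k _ _ h2 _ := by rw [maxStat_succ, maxStat_succ, h2]; omega

section Growth

variable {st : (ℕ → ℕ) → ℕ → ℕ} {n : ℕ} {s : ℕ → ℕ}

lemma GrowthSeq.le_stat (hst : IsGrowthStat st) (hs : GrowthSeq st n s) {k : ℕ} (hk : 1 ≤ k)
    (hkn : k ≤ n) : s k ≤ st s k := by
  induction k, hk using Nat.le_induction with
  | base => simp [hs.1]
  | succ k hk ih =>
    have h1 := hs.2 k hk (by omega)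
    have h2 := hst.mono s k hk
    have h3 := hst.eq_succ s k hk (ih (by omega))
    omega

lemma GrowthSeq.stat_lt (hst : IsGrowthStat st) (hs : GrowthSeq st n s) {k : ℕ} (hk : 1 ≤ k)
    (hkn : k ≤ n) : st s k < k := by
  induction k, hk using Nat.le_induction with
  | base => simp [hst.one s hs.1]
  | succ k hk ih =>
    have h1 := hst.le_succ s k hk (hs.2 k hk (by omega))
    have h2 := ih (by omega)
    omega

lemma GrowthSeq.le_of_stat_eq (hst : IsGrowthStat st) (hs : GrowthSeq st n s) {k : ℕ} (hk : 1 ≤ k)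
    (hkn : k ≤ n) (h : st s k + 1 = k) : k ≤ s k + 1 := by
  induction k, hk using Nat.le_induction with
  | base => omega
  | succ k hk ih =>
    have h1 := hst.le_succ s k hk (hs.2 k hk (by omega))
    have h2 := hs.stat_lt hst hk (by omega)
    have h3 := ih (by omega) (by omega)
    have h4 := hst.eq_of_le s k hk (hs.le_stat hst hk (by omega))
    omega

/-- The word `0, 1, …, a, a, …, a, x, b (N + 1), b (N + 2), …` with `x` at position `N`. -/
def cappedPrefix (N a x : ℕ) (b : ℕ → ℕ) (i : ℕ) : ℕ :=
  if i < N then min (i - 1) a else if i = N then x else b i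

lemma cappedPrefix_of_lt {N a x i : ℕ} {b : ℕ → ℕ} (h : i < N) :
    cappedPrefix N a x b i = min (i - 1) a := if_pos h

lemma cappedPrefix_self {N a x : ℕ} {b : ℕ → ℕ} : cappedPrefix N a x b N = x := by
  simp [cappedPrefix]

lemma cappedPrefix_of_gt {N a x i : ℕ} {b : ℕ → ℕ} (h : N < i) :
    cappedPrefix N a x b i = b i := by
  rw [cappedPrefix, if_neg (by omega), if_neg (by omega)]

lemma cappedPrefix_one {N a x : ℕ} {b : ℕ → ℕ} (hN : 1 ≤ N)
    (h : x = a ∧ a < N ∨ x < a ∧ a + 1 < N) : cappedPrefix N a x b 1 = 0 := by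
  rcases hN.eq_or_lt with rfl | hN
  · rw [cappedPrefix_self]; omega
  · rw [cappedPrefix_of_lt hN]; omega

lemma stat_cappedPrefix_of_lt (hst : IsGrowthStat st) {N a x i : ℕ} {b : ℕ → ℕ}
    (hi : 1 ≤ i) (hiN : i < N) : st (cappedPrefix N a x b) i = min (i - 1) a := by
  induction i, hi using Nat.le_induction with
  | base => rw [hst.one _ (by simp [cappedPrefix_of_lt hiN])]; simp
  | succ i hi ih =>
    have h0 := ih (by omega)
    have h1 := hst.eq_of_le (cappedPrefix N a x b) i hi
    have h2 := hst.eq_succ (cappedPrefix N a x b) i hi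
    rw [cappedPrefix_of_lt hiN, cappedPrefix_of_lt (by omega : i < N)] at h1 h2
    omega

lemma stat_cappedPrefix_self (hst : IsGrowthStat st) {N a x : ℕ} {b : ℕ → ℕ} (hN : 1 ≤ N)
    (h : x = a ∧ a < N ∨ x < a ∧ a + 1 < N) : st (cappedPrefix N a x b) N = a := by
  have h1 : cappedPrefix N a x b 1 = 0 := cappedPrefix_one hN h
  obtain rfl | ⟨j, hj, rfl⟩ : N = 1 ∨ ∃ j, 1 ≤ j ∧ N = j + 1 := by
    rcases hN.eq_or_lt with h | h
    · exact Or.inl h.symm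
    · exact Or.inr ⟨N - 1, by omega, by omega⟩
  · rw [hst.one _ h1]; omega
  · have h0 := stat_cappedPrefix_of_lt (a := a) (x := x) (b := b) hst hj (by omega : j < j + 1)
    have h1 := hst.eq_of_le (cappedPrefix (j + 1) a x b) j hj
    have h2 := hst.eq_succ (cappedPrefix (j + 1) a x b) j hj
    rw [cappedPrefix_self, cappedPrefix_of_lt (Nat.lt_add_one j)] at h1 h2
    omega

lemma cappedPrefix_succ_le (hst : IsGrowthStat st) {N a x i : ℕ} {b : ℕ → ℕ}
    (h : x = a ∧ a < N ∨ x < a ∧ a + 1 < N) (hi : 1 ≤ i) (hiN : i < N) :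
    cappedPrefix N a x b (i + 1) ≤ st (cappedPrefix N a x b) i + 1 := by
  rw [stat_cappedPrefix_of_lt hst hi hiN]
  rcases (Nat.succ_le_of_lt hiN).eq_or_lt with rfl | h'
  · rw [cappedPrefix_self]; omega
  · rw [cappedPrefix_of_lt h']; omega

lemma stat_le_stat_of_agree (hst : IsGrowthStat st) {s t : ℕ → ℕ} {j i : ℕ} (hj : 1 ≤ j)
    (hji : j ≤ i) (h : ∀ l, j ≤ l → l ≤ i → s l = t l) (hle : st s j ≤ st t j) :
    st s i ≤ st t i := by
  induction i, hji using Nat.le_induction with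
  | base => exact hle
  | succ i hji ih =>
    exact hst.step_le_step s t i (by omega) (h i hji (by omega)) (h _ (by omega) le_rfl)
      (ih fun l h1 h2 => h l h1 (by omega))

end Growth

section Mu

variable {X : (ℕ → ℕ) → Prop} {st : (ℕ → ℕ) → ℕ → ℕ} {n k : ℕ} {b s : ℕ → ℕ}

lemma muVal_le (hs : X s) (hsb : ∀ i, k < i → i ≤ n → s i = b i) :
    muVal X st n k b ≤ st s (k + 1) :=
  Nat.sInf_le ⟨s, hs, hsb, rfl⟩

lemma exists_muVal_eq (st : (ℕ → ℕ) → ℕ → ℕ) (hb : AdmissibleSuffix X n k b) :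
    ∃ s, X s ∧ (∀ i, k < i → i ≤ n → s i = b i) ∧ st s (k + 1) = muVal X st n k b := by
  obtain ⟨s, hs, hsb⟩ := hb
  exact Nat.sInf_mem (s := {v | ∃ s, X s ∧ (∀ i, k < i → i ≤ n → s i = b i) ∧ st s (k + 1) = v})
    ⟨_, s, hs, hsb, rfl⟩

lemma eq_update_of_agree {x : ℕ} (hk : s k = x) (hsb : ∀ i, k < i → i ≤ n → s i = b i) :
    ∀ i, k - 1 < i → i ≤ n → s i = Function.update b k x i := by
  intro i hi hin
  rcases eq_or_ne i k with rfl | hik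
  · simp [hk]
  · rw [Function.update_of_ne hik, hsb i (by omega) hin]

lemma agree_of_eq_update {x : ℕ} (hsb : ∀ i, k - 1 < i → i ≤ n → s i = Function.update b k x i) :
    ∀ i, k < i → i ≤ n → s i = b i := by
  intro i hi hin
  rw [hsb i (by omega) hin, Function.update_of_ne (by omega)]

lemma muVal_growthSeq_last (hst : IsGrowthStat st) (hn : 1 ≤ k + 1)
    (hb : AdmissibleSuffix (GrowthSeq st (k + 1)) (k + 1) k b) :
    muVal (GrowthSeq st (k + 1)) st (k + 1) k b = b (k + 1) := by
  obtain ⟨t, ht, htb, hmu⟩ := exists_muVal_eq st hb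
  have h1 := ht.le_stat hst hn le_rfl
  have h2 := ht.stat_lt hst hn le_rfl
  rw [htb _ (Nat.lt_add_one k) le_rfl] at h1
  have hcond : b (k + 1) = b (k + 1) ∧ b (k + 1) < k + 1 ∨
      b (k + 1) < b (k + 1) ∧ b (k + 1) + 1 < k + 1 := by omega
  have h3 : muVal (GrowthSeq st (k + 1)) st (k + 1) k b ≤ _ :=
    muVal_le (s := cappedPrefix (k + 1) (b (k + 1)) (b (k + 1)) b)
      ⟨cappedPrefix_one hn hcond, fun i hi hin => cappedPrefix_succ_le hst hcond hi hin⟩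
      (fun i hi hin => by
        obtain rfl : i = k + 1 := by omega
        exact cappedPrefix_self)
  rw [stat_cappedPrefix_self hst hn hcond] at h3
  omega

lemma muVal_growthSeq_eq_iff (hst : IsGrowthStat st) (hkn : k < n)
    (hb : AdmissibleSuffix (GrowthSeq st n) n k b) :
    muVal (GrowthSeq st n) st n k b = k ↔ b (k + 1) = k := by
  obtain ⟨t, ht, htb, hmu⟩ := exists_muVal_eq st hb
  have h1 := ht.le_stat hst (Nat.le_add_left 1 k) hkn
  have h2 := ht.stat_lt hst (Nat.le_add_left 1 k) hkn
  have h3 := ht.le_of_stat_eq hst (Nat.le_add_left 1 k) hkn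
  rw [htb _ (Nat.lt_add_one k) hkn] at h1 h3
  omega

lemma muVal_growthSeq_update (hst : IsGrowthStat st) (hk : 1 ≤ k) (hkn : k < n)
    (hb : AdmissibleSuffix (GrowthSeq st n) n k b) {x : ℕ}
    (hx : x ∈ alphaSet (GrowthSeq st n) n k b) (hbx : b (k + 1) ≤ x) :
    muVal (GrowthSeq st n) st n (k - 1) (Function.update b k x) =
      max x (muVal (GrowthSeq st n) st n k b) := by
  have lower : ∀ u, GrowthSeq st n u → u k = x → (∀ i, k < i → i ≤ n → u i = b i) →
      max x (muVal (GrowthSeq st n) st n k b) ≤ st u k := by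
    intro u hu huk hub
    have h1 := hu.le_stat hst hk hkn.le
    have h2 := hst.eq_of_le u k hk h1 (by rw [huk, hub _ (Nat.lt_add_one k) hkn]; exact hbx)
    have h3 : muVal (GrowthSeq st n) st n k b ≤ _ := muVal_le hu hub
    omega
  have hk' : k - 1 + 1 = k := by omega
  obtain ⟨u, hu, huk, hub⟩ := hx
  apply le_antisymm
  · obtain ⟨t, ht, htb, hmu⟩ := exists_muVal_eq st hb
    have hM := lower u hu huk hub
    set M := max x (muVal (GrowthSeq st n) st n k b) with hMdef
    have hlt := hu.stat_lt hst hk hkn.le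
    have htop := hu.le_of_stat_eq hst hk hkn.le
    have hcond : x = M ∧ M < k ∨ x < M ∧ M + 1 < k := by omega
    set w := cappedPrefix k M x b
    have hwk : w k = x := cappedPrefix_self
    have hwb : ∀ i, k < i → i ≤ n → w i = b i := fun i hi _ => cappedPrefix_of_gt hi
    have hstk : st w k = M := stat_cappedPrefix_self hst hk hcond
    have hstk1 : st w (k + 1) = M := by
      rw [hst.eq_of_le w k hk (by omega) (by rw [hwb _ (Nat.lt_add_one k) hkn]; omega), hstk]
    have hw : GrowthSeq st n w := by
      refine ⟨cappedPrefix_one hk hcond, fun i hi hin => ?_⟩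
      rcases lt_trichotomy i k with hik | rfl | hik
      · exact cappedPrefix_succ_le hst hcond hi hik
      · rw [hwb _ (Nat.lt_add_one i) hin]; omega
      · have h1 := ht.2 i hi hin
        have h2 : st t i ≤ st w i := stat_le_stat_of_agree hst (Nat.le_add_left 1 k) hik
          (fun l h1 h2 => by rw [htb l h1 (by omega), hwb l h1 (by omega)]) (by omega)
        rw [htb _ (by omega) hin] at h1
        rw [hwb _ (by omega) hin]
        omega
    have h : muVal (GrowthSeq st n) st n (k - 1) (Function.update b k x) ≤ _ :=
      muVal_le hw (eq_update_of_agree hwk hwb)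
    rwa [hk', hstk] at h
  · obtain ⟨t, ht, htb, hmu⟩ := exists_muVal_eq (k := k - 1) (b := Function.update b k x) st
      ⟨u, hu, eq_update_of_agree huk hub⟩
    rw [hk'] at hmu
    rw [← hmu]
    exact lower t ht (by rw [htb k (by omega) hkn.le, Function.update_self])
      (agree_of_eq_update htb)

lemma muVal_lvStat (hkn : k < n) (hb : AdmissibleSuffix X n k b) :
    muVal X lvStat n k b = b (k + 1) := by
  obtain ⟨t, -, htb, hmu⟩ := exists_muVal_eq lvStat hb
  rw [← hmu, lvStat, htb _ (Nat.lt_add_one k) hkn]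

end Mu

/-- For `Y_n` one of `A_n`, `R_n`, `S_n` with its defining statistic,
and `b = b_{k+1} … b_n` an admissible suffix in `Y_n`: (1) if `b` has length one
then `μ_Y(b) = b n`; (2) `μ_Y(b) = k` iff `b_{k+1} = k`; (3) if `x ∈ α_Y(b)` and
`x ≥ b_{k+1}` then `μ_Y(xb) = max {x, μ_Y(b)}`. -/
theorem mu_basic_properties
    (n k : ℕ) (hk1 : 1 ≤ k) (hkn : k < n)
    (Y : (ℕ → ℕ) → Prop) (st : (ℕ → ℕ) → ℕ → ℕ)
    (hY : (Y = memA n ∧ st = ascStat) ∨ (Y = memR n ∧ st = maxStat) ∨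
          (Y = memS n ∧ st = lvStat))
    (b : ℕ → ℕ) (hb : AdmissibleSuffix Y n k b) :
    (k = n - 1 → muVal Y st n k b = b n) ∧
    (muVal Y st n k b = k ↔ b (k + 1) = k) ∧
    (∀ x ∈ alphaSet Y n k b, b (k + 1) ≤ x →
      muVal Y st n (k - 1) (Function.update b k x) = max x (muVal Y st n k b)) := by
  have growth (hst : IsGrowthStat st) (hY : Y = GrowthSeq st n) :
      (k = n - 1 → muVal Y st n k b = b n) ∧
      (muVal Y st n k b = k ↔ b (k + 1) = k) ∧
      (∀ x ∈ alphaSet Y n k b, b (k + 1) ≤ x →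
        muVal Y st n (k - 1) (Function.update b k x) = max x (muVal Y st n k b)) := by
    subst hY
    refine ⟨fun h => ?_, muVal_growthSeq_eq_iff hst hkn hb,
      fun x hx hbx => muVal_growthSeq_update hst hk1 hkn hb hx hbx⟩
    obtain rfl : n = k + 1 := by omega
    exact muVal_growthSeq_last hst (by omega) hb
  rcases hY with ⟨rfl, rfl⟩ | ⟨rfl, rfl⟩ | ⟨rfl, rfl⟩
  · exact growth isGrowthStat_ascStat rfl
  · exact growth isGrowthStat_maxStat rfl
  · rw [muVal_lvStat hkn hb]
    refine ⟨fun h => by rw [h, Nat.sub_add_cancel (by omega)], Iff.rfl, ?_⟩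
    rintro x ⟨u, hu, huk, hub⟩ hbx
    rw [muVal_lvStat (by omega) ⟨u, hu, eq_update_of_agree huk hub⟩,
      Nat.sub_add_cancel hk1, Function.update_self, max_eq_left hbx]
end

section
/- Let b be an admissible suffix in S_n. If b is the empty sequence, then α_S(b) = {0,1,…,n−1}. If b = b_{k+1} b_{k+2} … b_n with 1 ≤ k < n, then: α_S(b) = {k−1} if b_{k+1} = k; and α_S(b) = {C, C+1, …, k−1} with C = max{0, b_{k+1}−1} if 0 ≤ b_{k+1} ≤ k−1. -/
/-- The entry of a staircase word at position `k` is less than `k`. -/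
theorem memS.lt {n : ℕ} {s : ℕ → ℕ} (hs : memS n s) {k : ℕ} (hk : 1 ≤ k) (hkn : k ≤ n) :
    s k < k := by
  induction k, hk using Nat.le_induction with
  | base => simp [hs.1]
  | succ k hk ih =>
    have h_step := hs.2 k hk (by omega)
    have h_prev := ih (by omega)
    omega

/-- Replacing the first `k` entries of a staircase word by `0, 1, …, x, x, …, x` gives a
staircase word, provided that the next entry is at most `x + 1`. -/
theorem memS.ite_min {n k x : ℕ} {s : ℕ → ℕ} (hs : memS n s) (hk : 1 ≤ k) (hx : x < k)
    (h : k < n → s (k + 1) ≤ x + 1) :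
    memS n (fun i => if i ≤ k then min (i - 1) x else s i) := by
  refine ⟨by simp [hk], fun i hi hin => ?_⟩
  have h_step := hs.2 i hi hin
  rcases lt_trichotomy i k with hik | rfl | hik
  · simp only [if_pos hik.le, if_pos (Nat.succ_le_of_lt hik)]
    omega
  · have h_next := h hin
    simp only [le_refl, if_true, if_neg (Nat.not_succ_le_self i)]
    omega
  · simpa only [if_neg (show ¬ i ≤ k by omega), if_neg (show ¬ i + 1 ≤ k by omega)] using h_step

theorem mem_alphaSet_memS_iff {n k x : ℕ} {b : ℕ → ℕ} (hk : 1 ≤ k) (hkn : k ≤ n)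
    (hb : AdmissibleSuffix (memS n) n k b) :
    x ∈ alphaSet (memS n) n k b ↔ x < k ∧ (k < n → b (k + 1) ≤ x + 1) := by
  constructor
  · rintro ⟨s, hs, rfl, hsb⟩
    refine ⟨hs.lt hk hkn, fun h => ?_⟩
    rw [← hsb (k + 1) k.lt_succ_self h]
    exact hs.2 k hk h
  · rintro ⟨hx, h⟩
    obtain ⟨s, hs, hsb⟩ := hb
    refine ⟨_, hs.ite_min hk hx fun hlt => ?_, ?_, fun i hki hin => ?_⟩
    · rw [hsb (k + 1) k.lt_succ_self hlt]
      exact h hlt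
    · simp only [le_refl, if_true]
      omega
    · simpa only [if_neg (show ¬ i ≤ k by omega)] using hsb i hki hin

/-- Characterization of `α_S(b)` for admissible suffixes in `S_n`. -/
theorem alpha_S_characterization
    (n : ℕ) (hn : 1 ≤ n) :
    (∀ b : ℕ → ℕ, alphaSet (memS n) n n b = Set.Iio n) ∧
    (∀ k, 1 ≤ k → k < n → ∀ b : ℕ → ℕ, AdmissibleSuffix (memS n) n k b →
      (b (k + 1) = k → alphaSet (memS n) n k b = {k - 1}) ∧
      (b (k + 1) ≤ k - 1 →
        alphaSet (memS n) n k b = Set.Icc (max 0 (b (k + 1) - 1)) (k - 1))) := by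
  refine ⟨fun b => ?_, fun k hk hkn b hb => ⟨fun h => ?_, fun h => ?_⟩⟩
  · have hb : AdmissibleSuffix (memS n) n n b :=
      ⟨fun _ => 0, ⟨rfl, by simp⟩, by omega⟩
    ext x
    simp [mem_alphaSet_memS_iff hn le_rfl hb]
  · ext x
    rw [mem_alphaSet_memS_iff hk hkn.le hb, Set.mem_singleton_iff]
    omega
  · ext x
    rw [mem_alphaSet_memS_iff hk hkn.le hb, Set.mem_Icc]
    omega
end

section
/- If s and t are sequences in SE_n (subexcedant sequences of length n) such that t is the successor of s in SE_n with respect to the Co-Reflected Gray Code order ≺_c, then s and t differ in exactly one position (the list of SE_n in ≺_c order is a 1-Gray code). -/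
/-- The quantity whose parity decides the direction of the Co-RGC order at position `k`. -/
def corgcWeight (n : ℕ) (s : ℕ → ℕ) (k : ℕ) : ℕ :=
  (∑ i ∈ Finset.Ioc k n, s i) + (n - k)

lemma corgcWeight_congr {n k : ℕ} {s t : ℕ → ℕ} (h : ∀ i, k < i → i ≤ n → s i = t i) :
    corgcWeight n s k = corgcWeight n t k := by
  unfold corgcWeight
  congr 1
  refine Finset.sum_congr rfl fun i hi => ?_
  rw [Finset.mem_Ioc] at hi
  exact h i hi.1 hi.2

lemma corgcWeight_eq_succ {n k : ℕ} (s : ℕ → ℕ) (hk : k < n) :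
    corgcWeight n s k = corgcWeight n s (k + 1) + s (k + 1) + 1 := by
  have h : Finset.Ioc k n = insert (k + 1) (Finset.Ioc (k + 1) n) := by
    ext i
    simp only [Finset.mem_Ioc, Finset.mem_insert]
    omega
  unfold corgcWeight
  rw [h, Finset.sum_insert (by simp)]
  omega

/-- `x` comes before `y` among the values at a position of weight `w`. -/
def corgcBefore (w x y : ℕ) : Prop :=
  (Even w ∧ y < x) ∨ (¬ Even w ∧ x < y)

lemma corgcLt_of_before {n k : ℕ} {s t : ℕ → ℕ} (h1 : 1 ≤ k) (hn : k ≤ n)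
    (heq : ∀ i, k < i → i ≤ n → s i = t i) (h : corgcBefore (corgcWeight n s k) (s k) (t k)) :
    corgcLt n s t := by
  refine ⟨k, h1, hn, heq, ?_, h⟩
  rcases h with h | h <;> omega

lemma memSE.le {n : ℕ} {s : ℕ → ℕ} (hs : memSE n s) {j : ℕ} (h1 : 1 ≤ j) (hn : j ≤ n) :
    s j ≤ j - 1 := by
  rcases h1.eq_or_lt with rfl | h
  · exact hs.1.le
  · have := hs.2 (j - 1) (by omega) (by omega)
    rwa [Nat.sub_add_cancel h1] at this

lemma memSE.update {n : ℕ} {s : ℕ → ℕ} (hs : memSE n s) {j x : ℕ} (hx : x ≤ j - 1) :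
    memSE n (Function.update s j x) := by
  refine ⟨?_, fun k hk hkn => ?_⟩
  · rcases eq_or_ne 1 j with rfl | h
    · simpa using hx
    · rw [Function.update_of_ne h]
      exact hs.1
  · rcases eq_or_ne (k + 1) j with rfl | h
    · simpa using hx
    · rw [Function.update_of_ne h]
      exact hs.2 k hk hkn

lemma update_eq_of_lt {s : ℕ → ℕ} {j x i : ℕ} (h : j < i) : Function.update s j x i = s i :=
  Function.update_of_ne h.ne' _ _

/-- Successive subexcedant sequences in the Co-RGC order differ in
exactly one position (1-Gray code). -/
theorem corgc_subexcedant_one_gray_code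
    (n : ℕ) (s t : ℕ → ℕ) (hsucc : IsSuccessor (memSE n) (corgcLt n) s t) :
    ∃ k, 1 ≤ k ∧ k ≤ n ∧ s k ≠ t k ∧
      ∀ i, 1 ≤ i → i ≤ n → i ≠ k → s i = t i := by
  obtain ⟨hs, ht, ⟨k, hk1, hkn, heq, hne, hlt⟩, hno⟩ := hsucc
  change corgcBefore (corgcWeight n s k) (s k) (t k) at hlt
  have hsk := hs.le hk1 hkn
  have htk := ht.le hk1 hkn
  have hw : corgcWeight n s k = corgcWeight n t k := corgcWeight_congr heq
  have hmid : ∀ x, x ≤ k - 1 → corgcBefore (corgcWeight n s k) (s k) x →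
      ¬ corgcBefore (corgcWeight n s k) x (t k) := by
    intro x hx hsx hxt
    refine hno ⟨Function.update s k x, hs.update hx, ?_, ?_⟩
    · exact corgcLt_of_before hk1 hkn (fun i hi _ => (update_eq_of_lt hi).symm) (by simpa using hsx)
    · refine corgcLt_of_before hk1 hkn (fun i hi hin => (update_eq_of_lt hi).trans (heq i hi hin)) ?_
      rw [corgcWeight_congr (t := s) fun i hi _ => update_eq_of_lt hi]
      simpa using hxt
  have hslast : ∀ j, 1 ≤ j → j < k → ∀ x, x ≤ j - 1 →
      ¬ corgcBefore (corgcWeight n s j) (s j) x := by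
    intro j hj hjk x hx hsx
    refine hno ⟨Function.update s j x, hs.update hx, ?_, ?_⟩
    · exact corgcLt_of_before hj (by omega) (fun i hi _ => (update_eq_of_lt hi).symm)
        (by simpa using hsx)
    · refine corgcLt_of_before hk1 hkn
        (fun i hi hin => (update_eq_of_lt (hjk.trans hi)).trans (heq i hi hin)) ?_
      rw [corgcWeight_congr (t := s) fun i hi _ => update_eq_of_lt (hjk.trans hi),
        update_eq_of_lt hjk]
      exact hlt
  have htfirst : ∀ j, 1 ≤ j → j < k → ∀ x, x ≤ j - 1 →
      ¬ corgcBefore (corgcWeight n t j) x (t j) := by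
    intro j hj hjk x hx hxt
    refine hno ⟨Function.update t j x, ht.update hx, ?_, ?_⟩
    · refine corgcLt_of_before hk1 hkn
        (fun i hi hin => (heq i hi hin).trans (update_eq_of_lt (hjk.trans hi)).symm) ?_
      rw [update_eq_of_lt hjk]
      exact hlt
    · refine corgcLt_of_before hj (by omega) (fun i hi _ => update_eq_of_lt hi) ?_
      rw [corgcWeight_congr (t := t) fun i hi _ => update_eq_of_lt hi]
      simpa using hxt
  have hadj : s k = t k + 1 ∨ t k = s k + 1 := by
    rcases hlt with ⟨he, h⟩ | ⟨he, h⟩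
    · have := hmid (s k - 1) (by omega) (Or.inl ⟨he, by omega⟩)
      simp only [corgcBefore, he, true_and, not_true_eq_false, false_and, or_false] at this
      omega
    · have := hmid (s k + 1) (by omega) (Or.inr ⟨he, by omega⟩)
      simp only [corgcBefore, he, true_and, not_false_eq_true, false_and, false_or] at this
      omega
  have hpar : ∀ d j, j + d + 1 = k →
      (Even (corgcWeight n s j) ↔ ¬ Even (corgcWeight n t j)) ∧ (1 ≤ j → s j = t j) := by
    have heq_of_par : ∀ j, j < k → (Even (corgcWeight n s j) ↔ ¬ Even (corgcWeight n t j)) →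
        1 ≤ j → s j = t j := by
      intro j hjk hp hj
      have hsj := hs.le hj (by omega)
      have htj := ht.le hj (by omega)
      have s0 := hslast j hj hjk 0 (by omega)
      have s1 := hslast j hj hjk (j - 1) le_rfl
      have t0 := htfirst j hj hjk 0 (by omega)
      have t1 := htfirst j hj hjk (j - 1) le_rfl
      unfold corgcBefore at s0 s1 t0 t1
      by_cases h : Even (corgcWeight n t j) <;> simp only [h, hp] at s0 s1 t0 t1 <;> simp at * <;>
        omega
    intro d
    induction d with
    | zero =>
      intro j hj
      obtain rfl : j + 1 = k := by omega
      have hp : Even (corgcWeight n s j) ↔ ¬ Even (corgcWeight n t j) := by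
        rw [corgcWeight_eq_succ s (by omega), corgcWeight_eq_succ t (by omega), hw]
        simp only [Nat.even_iff]
        omega
      exact ⟨hp, heq_of_par j (by omega) hp⟩
    | succ d ih =>
      intro j hj
      obtain ⟨ihp, ihe⟩ := ih (j + 1) (by omega)
      have hp : Even (corgcWeight n s j) ↔ ¬ Even (corgcWeight n t j) := by
        rw [corgcWeight_eq_succ s (by omega), corgcWeight_eq_succ t (by omega), ihe (by omega)]
        simp only [Nat.even_iff] at ihp ⊢
        omega
      exact ⟨hp, heq_of_par j (by omega) hp⟩
  refine ⟨k, hk1, hkn, hne, fun i hi hin hik => ?_⟩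
  rcases lt_or_gt_of_ne hik with h | h
  · exact (hpar (k - i - 1) i (by omega)).2 hi
  · exact heq i h hin
end

section
/- Let Y_n be one of the sets A_n (ascent sequences) or R_n (restricted growth functions) of length n. If s and t are sequences in Y_n such that t is the successor of s in Y_n with respect to the Co-Reflected Gray Code order ≺_c, then there exists a position k such that s_i = t_i for every index i not in {k, k+1}; that is, s and t differ in at most 2 positions and these positions are adjacent (the lists of A_n and R_n in ≺_c order are 2-adjacent Gray codes). -/
namespace CoRGC

/-- `F` is the update rule of a growth statistic: `F a x y` is the new value of the statistic
when `y` is appended to a sequence with statistic `a` and last entry `x`. -/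
structure IsGrowthRule (F : ℕ → ℕ → ℕ → ℕ) : Prop where
  mono : ∀ {a a'} x y, a ≤ a' → F a x y ≤ F a' x y
  anti : ∀ a {x x'} y, x ≤ x' → F a x' y ≤ F a x y
  le_self : ∀ a x y, a ≤ F a x y
  le_succ : ∀ {a} x {y}, y ≤ a + 1 → F a x y ≤ a + 1
  zero : ∀ a x, F a x 0 = a
  diag : ∀ a, F a a (a + 1) = a + 1
  tight : ∀ {a y}, F a a y = a + 1 → a + 1 ≤ y

/-- The statistic `f` on nonempty prefixes is computed by the update rule `F`. -/
structure IsStatOf (F : ℕ → ℕ → ℕ → ℕ) (f : (ℕ → ℕ) → ℕ → ℕ) : Prop where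
  one : ∀ s : ℕ → ℕ, s 1 = 0 → f s 1 = 0
  step : ∀ s k, f s (k + 1 + 1) = F (f s (k + 1)) (s (k + 1)) (s (k + 1 + 1))

/-- Length-`n` sequences whose entries exceed the statistic `f` of the preceding prefix by
at most one. -/
def memStat (f : (ℕ → ℕ) → ℕ → ℕ) (n : ℕ) (s : ℕ → ℕ) : Prop :=
  s 1 = 0 ∧ ∀ k, 1 ≤ k → k < n → s (k + 1) ≤ f s k + 1

lemma isGrowthRule_asc : IsGrowthRule fun a x y => a + if x < y then 1 else 0 := by
  constructor <;> intros <;> grind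

lemma isGrowthRule_max : IsGrowthRule fun a _ y => max a y := by
  constructor <;> intros <;> grind

lemma isStatOf_ascStat : IsStatOf (fun a x y => a + if x < y then 1 else 0) ascStat where
  one s _ := by simp [ascStat]
  step s k := by
    rw [ascStat, ascStat, ← Finset.insert_Ico_right_eq_Ico_add_one (by omega), Finset.filter_insert]
    split_ifs with h
    · rw [Finset.card_insert_of_notMem (by simp)]
    · rfl

lemma isStatOf_maxStat : IsStatOf (fun a _ y => max a y) maxStat where
  one s h := by simp [maxStat, h]
  step s k := by
    rw [maxStat, maxStat, ← Finset.insert_Icc_right_eq_Icc_add_one (by omega), Finset.sup_insert]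
    exact max_comm _ _

/-- The sequence `0, 1, …, p - 1, v, s (p + 2), s (p + 3), …`. -/
def stairs (p v : ℕ) (s : ℕ → ℕ) (i : ℕ) : ℕ :=
  if i ≤ p then i - 1 else if i = p + 1 then v else s i

section Stat

variable {F : ℕ → ℕ → ℕ → ℕ} {f : (ℕ → ℕ) → ℕ → ℕ} {n : ℕ} {s : ℕ → ℕ}

lemma stat_le (hF : IsGrowthRule F) (hf : IsStatOf F f) (hs : memStat f n s) :
    ∀ k, k < n → f s (k + 1) ≤ k
  | 0, _ => (hf.one s hs.1).le
  | k + 1, hk => by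
    have ih := stat_le hF hf hs k (by omega)
    have := hF.le_succ (s (k + 1)) (hs.2 (k + 1) (by omega) hk)
    rw [hf.step]
    omega

lemma apply_le (hF : IsGrowthRule F) (hf : IsStatOf F f) (hs : memStat f n s) :
    ∀ k, k < n → s (k + 1) ≤ k
  | 0, _ => hs.1.le
  | k + 1, hk => by
    have := stat_le hF hf hs k (by omega)
    have := hs.2 (k + 1) (by omega) hk
    omega

lemma apply_eq_of_stat_eq (hF : IsGrowthRule F) (hf : IsStatOf F f) (hs : memStat f n s) :
    ∀ k, k < n → f s (k + 1) = k → ∀ i ≤ k, s (i + 1) = i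
  | 0, _, _, i, hi => by
    obtain rfl : i = 0 := by omega
    exact hs.1
  | k + 1, hk, h, i, hi => by
    have hle := stat_le hF hf hs k (by omega)
    have hsk := hs.2 (k + 1) (by omega) hk
    have := hF.le_succ (s (k + 1)) hsk
    rw [hf.step] at h
    have hst : f s (k + 1) = k := by omega
    have ih := apply_eq_of_stat_eq hF hf hs k (by omega) hst
    rcases hi.lt_or_eq with hi | rfl
    · exact ih i (by omega)
    · rw [hst, ih k le_rfl] at h
      have := hF.tight h
      omega

lemma apply_eq_of_apply_eq (hF : IsGrowthRule F) (hf : IsStatOf F f) (hs : memStat f n s)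
    {k : ℕ} (hk : k < n) (h : s (k + 1) = k) : ∀ i ≤ k, s (i + 1) = i := by
  intro i hi
  rcases hi.lt_or_eq with hi | rfl
  · obtain ⟨k, rfl⟩ : ∃ l, k = l + 1 := ⟨k - 1, by omega⟩
    have := stat_le hF hf hs k (by omega)
    have := hs.2 (k + 1) (by omega) hk
    exact apply_eq_of_stat_eq hF hf hs k (by omega) (by omega) i (by omega)
  · exact h

lemma stat_eq_of_apply_eq (hF : IsGrowthRule F) (hf : IsStatOf F f) :
    ∀ k, (∀ i ≤ k, s (i + 1) = i) → f s (k + 1) = k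
  | 0, h => hf.one s (h 0 le_rfl)
  | k + 1, h => by
    rw [hf.step, stat_eq_of_apply_eq hF hf k fun i hi => h i (by omega), h k (by omega),
      h (k + 1) le_rfl, hF.diag]

/-- A sequence stays admissible when its prefix is replaced by an admissible one whose statistic
is at least as large. -/
lemma memStat_of_suffix (hF : IsGrowthRule F) (hf : IsStatOf F f) (hs : memStat f n s)
    {w : ℕ → ℕ} {p : ℕ} (h1 : w 1 = 0) (hpre : ∀ k, 1 ≤ k → k ≤ p → w (k + 1) ≤ f w k + 1)
    (hsuf : ∀ i, p + 1 < i → w i = s i) (hp : f s (p + 1) ≤ f w (p + 1))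
    (hp' : p + 1 < n → f s (p + 1 + 1) ≤ f w (p + 1 + 1)) : memStat f n w := by
  have key : ∀ d, p + 1 + d < n → f s (p + 1 + d) ≤ f w (p + 1 + d) := by
    intro d hd
    induction d with
    | zero => exact hp
    | succ d ih =>
      rcases d.eq_zero_or_pos with rfl | h
      · exact hp' (by omega)
      · have h2 := ih (by omega)
        rw [← add_assoc, add_right_comm p 1 d]
        rw [add_right_comm p 1 d] at h2
        rw [hf.step, hf.step, hsuf _ (by omega), hsuf _ (by omega)]
        exact hF.mono _ _ h2
  refine ⟨h1, fun k hk hkn => ?_⟩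
  rcases le_or_gt k p with h | h
  · exact hpre k hk h
  · obtain ⟨d, rfl⟩ := Nat.exists_eq_add_of_le h
    rw [hsuf _ (by omega)]
    exact (hs.2 _ hk hkn).trans (Nat.succ_le_succ (key d hkn))

lemma stairs_apply_lt {p v i : ℕ} (hi : i < p) : stairs p v s (i + 1) = i := by
  simp [stairs, Nat.succ_le_of_lt hi]

lemma stairs_apply_self {p v : ℕ} : stairs p v s (p + 1) = v := by
  simp [stairs]

lemma stairs_apply_gt {p v i : ℕ} (hi : p + 1 < i) : stairs p v s i = s i := by
  rw [stairs, if_neg (by omega), if_neg (by omega)]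

lemma stat_stairs_lt (hF : IsGrowthRule F) (hf : IsStatOf F f) {p v i : ℕ} (hi : i < p) :
    f (stairs p v s) (i + 1) = i :=
  stat_eq_of_apply_eq hF hf i fun _ hl => stairs_apply_lt (hl.trans_lt hi)

lemma memStat_stairs_self (hF : IsGrowthRule F) (hf : IsStatOf F f) (hs : memStat f n s)
    {p : ℕ} (hp : p < n) : memStat f n (stairs p p s) := by
  have hid : ∀ i ≤ p, stairs p p s (i + 1) = i := fun i hi => by
    rcases hi.lt_or_eq with hi | rfl
    · exact stairs_apply_lt hi
    · exact stairs_apply_self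
  have hst : ∀ i ≤ p, f (stairs p p s) (i + 1) = i := fun i hi =>
    stat_eq_of_apply_eq hF hf i fun l hl => hid l (hl.trans hi)
  have hle := stat_le hF hf hs p hp
  refine memStat_of_suffix hF hf hs (hid 0 (Nat.zero_le p)) (fun k hk hkp => ?_)
    (fun i hi => stairs_apply_gt hi) ?_ fun hn => ?_
  · obtain ⟨k, rfl⟩ : ∃ l, k = l + 1 := ⟨k - 1, by omega⟩
    rw [hid _ hkp, hst _ (by omega)]
  · rwa [hst p le_rfl]
  · rw [hf.step, hf.step, hst p le_rfl, hid p le_rfl, stairs_apply_gt (by omega)]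
    rcases hle.lt_or_eq with h | h
    · have := hF.le_succ (s (p + 1)) (hs.2 (p + 1) (by omega) hn)
      have := hF.le_self p p (s (p + 1 + 1))
      omega
    · rw [h, apply_eq_of_stat_eq hF hf hs p hp h p le_rfl]

lemma memStat_stairs_zero (hF : IsGrowthRule F) (hf : IsStatOf F f) (hs : memStat f n s)
    {p : ℕ} (hp : p + 1 < n) (hne : s (p + 1 + 1) ≠ p + 1) :
    memStat f n (stairs (p + 1) 0 s) := by
  have hst : ∀ i ≤ p, f (stairs (p + 1) 0 s) (i + 1) = i := fun i hi =>
    stat_stairs_lt hF hf (by omega)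
  have hst' : f (stairs (p + 1) 0 s) (p + 1 + 1) = p := by
    rw [hf.step, hst p le_rfl, stairs_apply_self, hF.zero]
  have hle : f s (p + 1 + 1) ≤ p := by
    have h := stat_le hF hf hs (p + 1) hp
    have : f s (p + 1 + 1) ≠ p + 1 := fun h =>
      hne (apply_eq_of_stat_eq hF hf hs (p + 1) hp h _ le_rfl)
    omega
  refine memStat_of_suffix hF hf hs (stairs_apply_lt (Nat.succ_pos p)) (fun k hk hkp => ?_)
    (fun i hi => stairs_apply_gt hi) ?_ fun hn => ?_
  · obtain ⟨k, rfl⟩ : ∃ l, k = l + 1 := ⟨k - 1, by omega⟩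
    rw [hst _ (by omega)]
    rcases hkp.lt_or_eq with h | h
    · rw [stairs_apply_lt h]
    · rw [h, stairs_apply_self]
      omega
  · rwa [hst']
  · rw [hf.step, hf.step (stairs _ _ _), hst', stairs_apply_self, stairs_apply_gt (by omega)]
    exact (hF.mono _ _ hle).trans (hF.anti _ _ (Nat.zero_le _))

/-- The parity condition deciding the direction of `≺_c` at position `k`. -/
def EvenTail (n : ℕ) (s : ℕ → ℕ) (k : ℕ) : Prop :=
  Even ((∑ i ∈ Finset.Ioc k n, s i) + (n - k))

lemma evenTail_congr {t : ℕ → ℕ} {k : ℕ} (h : ∀ i, k < i → i ≤ n → s i = t i) :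
    EvenTail n s k ↔ EvenTail n t k := by
  rw [EvenTail, EvenTail, Finset.sum_congr rfl fun i hi => ?_]
  rw [Finset.mem_Ioc] at hi
  exact h i hi.1 hi.2

lemma evenTail_of_succ_eq_zero {k : ℕ} (hk : k < n) (h : s (k + 1) = 0) :
    EvenTail n s k ↔ ¬ EvenTail n s (k + 1) := by
  rw [EvenTail, EvenTail, ← Finset.insert_Ioc_add_one_left_eq_Ioc hk,
    Finset.sum_insert (by simp), h, zero_add, show n - k = n - (k + 1) + 1 by omega, ← add_assoc,
    Nat.even_add_one]

/-- An admissible sequence that is extremal in the order `≺_c` among those with the same entries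
from position `k` on (last for `q` true, first for `q` false) begins with `0, 1, …, k - 3`. -/
lemma apply_eq_of_extremal (hF : IsGrowthRule F) (hf : IsStatOf F f) (hs : memStat f n s)
    (q : Prop) {k : ℕ} (hk : k ≤ n)
    (hmin : ∀ u m, memStat f n u → 1 ≤ m → m < k → (∀ i, m < i → u i = s i) →
      (EvenTail n s m ↔ q) → s m ≤ u m)
    (hmax : ∀ u m, memStat f n u → 1 ≤ m → m < k → (∀ i, m < i → u i = s i) →
      (EvenTail n s m ↔ ¬ q) → u m ≤ s m)
    {i : ℕ} (hi : i + 2 < k) : s (i + 1) = i := by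
  obtain ⟨p, rfl⟩ : ∃ p, k = p + 3 := ⟨k - 3, by omega⟩
  by_cases hp : s (p + 1 + 1) = p + 1
  · exact apply_eq_of_apply_eq hF hf hs (by omega) hp i (by omega)
  have hlt := apply_le hF hf hs (p + 1) (by omega)
  by_cases hq : EvenTail n s (p + 1 + 1) ↔ q
  · have hw := memStat_stairs_zero hF hf hs (p := p) (by omega) hp
    have h0 := hmin _ (p + 1 + 1) hw (by omega) (by omega)
      (fun i hi => stairs_apply_gt hi) hq
    rw [stairs_apply_self, Nat.le_zero] at h0
    have hpar := evenTail_of_succ_eq_zero (n := n) (by omega) h0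
    have hge := hmax _ (p + 1) hw (by omega) (by omega) (fun i hi => by
      rcases (Nat.succ_le_of_lt hi).lt_or_eq with h | rfl
      · exact stairs_apply_gt h
      · rw [Nat.succ_eq_add_one, stairs_apply_self, h0]) (by tauto)
    rw [stairs_apply_lt (Nat.lt_succ_self p)] at hge
    have hle := apply_le hF hf hs p (by omega)
    exact apply_eq_of_apply_eq hF hf hs (by omega) (le_antisymm hle hge) i (by omega)
  · have hge := hmax _ (p + 1 + 1) (memStat_stairs_self hF hf hs (p := p + 1) (by omega))
      (by omega) (by omega) (fun i hi => stairs_apply_gt hi) (by tauto)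
    rw [stairs_apply_self] at hge
    omega

theorem two_adjacent_of_isStatOf (hF : IsGrowthRule F) (hf : IsStatOf F f) {t : ℕ → ℕ}
    (hsucc : IsSuccessor (memStat f n) (corgcLt n) s t) :
    ∃ k, ∀ i, 1 ≤ i → i ≤ n → i ≠ k → i ≠ k + 1 → s i = t i := by
  obtain ⟨hs, ht, ⟨k, hk1, hkn, hst, hne, hlt⟩, hno⟩ := hsucc
  have hlast : ∀ u m, memStat f n u → m < k → (∀ i, m < i → u i = s i) →
      ¬ corgcLt n s u := fun u m hu hmk hsuf hsu => by
    have hks : ∀ i, k ≤ i → u i = s i := fun i hi => hsuf i (by omega)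
    refine hno ⟨u, hu, hsu, k, hk1, hkn, fun i h1 h2 => ?_, ?_, ?_⟩
    · rw [hks i h1.le, hst i h1 h2]
    · rwa [hks k le_rfl]
    · change (EvenTail n u k ∧ _) ∨ (¬ EvenTail n u k ∧ _)
      rwa [evenTail_congr fun i h1 _ => hks i h1.le, hks k le_rfl]
  have hfirst : ∀ u m, memStat f n u → m < k → (∀ i, m < i → u i = t i) →
      ¬ corgcLt n u t := fun u m hu hmk hsuf hut => by
    have hks : ∀ i, k ≤ i → u i = t i := fun i hi => hsuf i (by omega)
    refine hno ⟨u, hu, ⟨k, hk1, hkn, fun i h1 h2 => ?_, ?_, ?_⟩, hut⟩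
    · rw [hks i h1.le, hst i h1 h2]
    · rwa [hks k le_rfl]
    · rwa [hks k le_rfl]
  have hs_eq : ∀ i, i + 2 < k → s (i + 1) = i := fun i hi =>
    apply_eq_of_extremal hF hf hs True hkn
      (fun u m hu hm1 hmk hsuf hq => by
        by_contra! h
        exact hlast u m hu hmk hsuf ⟨m, hm1, by omega, fun i hi _ => (hsuf i hi).symm, h.ne',
          Or.inl ⟨hq.2 trivial, h⟩⟩)
      (fun u m hu hm1 hmk hsuf hq => by
        by_contra! h
        exact hlast u m hu hmk hsuf ⟨m, hm1, by omega, fun i hi _ => (hsuf i hi).symm, h.ne,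
          Or.inr ⟨fun he => hq.1 he trivial, h⟩⟩) hi
  have ht_eq : ∀ i, i + 2 < k → t (i + 1) = i := fun i hi =>
    apply_eq_of_extremal hF hf ht False hkn
      (fun u m hu hm1 hmk hsuf hq => by
        by_contra! h
        exact hfirst u m hu hmk hsuf ⟨m, hm1, by omega, fun i hi _ => hsuf i hi, h.ne,
          Or.inr ⟨fun he => hq.1 ((evenTail_congr fun i hi _ => hsuf i hi).1 he), h⟩⟩)
      (fun u m hu hm1 hmk hsuf hq => by
        by_contra! h
        exact hfirst u m hu hmk hsuf ⟨m, hm1, by omega, fun i hi _ => hsuf i hi, h.ne',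
          Or.inl ⟨(evenTail_congr fun i hi _ => hsuf i hi).2 (hq.2 id), h⟩⟩) hi
  refine ⟨k - 1, fun i hi1 hin h1 h2 => ?_⟩
  rcases lt_or_ge k i with h | h
  · exact hst i h hin
  · obtain ⟨i, rfl⟩ : ∃ l, i = l + 1 := ⟨i - 1, by omega⟩
    rw [hs_eq i (by omega), ht_eq i (by omega)]

end Stat

end CoRGC

/-- For `Y_n` one of `A_n`, `R_n`, successive sequences in the
Co-RGC order differ in at most 2 adjacent positions (2-adjacent Gray codes). -/
theorem corgc_two_adjacent_gray_code
    (n : ℕ) (Y : (ℕ → ℕ) → Prop) (hY : Y = memA n ∨ Y = memR n)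
    (s t : ℕ → ℕ) (hsucc : IsSuccessor Y (corgcLt n) s t) :
    ∃ k, ∀ i, 1 ≤ i → i ≤ n → i ≠ k → i ≠ k + 1 → s i = t i := by
  rcases hY with rfl | rfl
  · exact CoRGC.two_adjacent_of_isStatOf CoRGC.isGrowthRule_asc CoRGC.isStatOf_ascStat hsucc
  · exact CoRGC.two_adjacent_of_isStatOf CoRGC.isGrowthRule_max CoRGC.isStatOf_maxStat hsucc
end

section
/- If s and t are sequences in S_n (staircase words of length n) such that t is the successor of s in S_n with respect to the Co-Reflected Gray Code order ≺_c, then there exists a position k such that s_i = t_i for every index i not in {k, k+1, k+2}; that is, s and t differ in at most 3 positions and these positions are adjacent (the list of S_n in ≺_c order is a 3-adjacent Gray code). -/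
/-- The parity statistic of the suffix after position `m` that directs the Co-RGC order. -/
def suffixStat (n : ℕ) (w : ℕ → ℕ) (m : ℕ) : ℕ :=
  (∑ i ∈ Finset.Ioc m n, w i) + (n - m)

theorem suffixStat_step {n m : ℕ} (w : ℕ → ℕ) (h : m < n) :
    suffixStat n w m = suffixStat n w (m + 1) + w (m + 1) + 1 := by
  have hI : Finset.Ioc m n = insert (m + 1) (Finset.Ioc (m + 1) n) := by
    ext i
    simp only [Finset.mem_Ioc, Finset.mem_insert]
    omega
  unfold suffixStat
  rw [hI, Finset.sum_insert (by simp)]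
  omega

theorem suffixStat_congr {n m : ℕ} {v w : ℕ → ℕ} (h : ∀ i, m < i → i ≤ n → v i = w i) :
    suffixStat n v m = suffixStat n w m := by
  unfold suffixStat
  rw [Finset.sum_congr rfl fun i hi => h i (Finset.mem_Ioc.1 hi).1 (Finset.mem_Ioc.1 hi).2]

theorem corgcLt_of_suffix {n m : ℕ} {v w : ℕ → ℕ} (h1 : 1 ≤ m) (hn : m ≤ n)
    (h : ∀ i, m < i → i ≤ n → v i = w i)
    (hlt : (suffixStat n v m % 2 = 0 ∧ w m < v m) ∨ (suffixStat n v m % 2 = 1 ∧ v m < w m)) :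
    corgcLt n v w := by
  refine ⟨m, h1, hn, h, by omega, ?_⟩
  simp only [Nat.even_iff]
  unfold suffixStat at hlt
  omega

/-- The word with suffix `b` after position `m`, value `x` at position `m`, and the
largest staircase prefix `0, 1, 2, …` before it. -/
def fillWord (b : ℕ → ℕ) (m x : ℕ) : ℕ → ℕ :=
  fun i => if m < i then b i else if i = m then x else i - 1

theorem fillWord_of_gt {b : ℕ → ℕ} {m x i : ℕ} (h : m < i) : fillWord b m x i = b i :=
  if_pos h

theorem fillWord_self {b : ℕ → ℕ} {m x : ℕ} : fillWord b m x m = x := by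
  simp [fillWord]

theorem memS_le {n : ℕ} {w : ℕ → ℕ} (hw : memS n w) {i : ℕ} (h1 : 1 ≤ i) (hn : i ≤ n) :
    w i + 1 ≤ i := by
  induction i, h1 using Nat.le_induction with
  | base => simp [hw.1]
  | succ i h1 ih =>
    have := ih (by omega)
    have := hw.2 i h1 (by omega)
    omega

theorem memS_fillWord {n m x : ℕ} {b : ℕ → ℕ} (hb : memS n b) (h1 : 1 ≤ m) (hx : x + 1 ≤ m)
    (hbx : m < n → b (m + 1) ≤ x + 1) : memS n (fillWord b m x) := by
  refine ⟨?_, fun i hi hin => ?_⟩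
  · simp only [fillWord]
    split_ifs <;> omega
  · have := hb.2 i hi hin
    simp only [fillWord]
    by_cases him : i = m
    · subst him
      have := hbx hin
      simpa using this
    · split_ifs <;> omega

/-- A word that is last among the staircase words sharing its suffix from position `k` on. -/
theorem last_value {n k m : ℕ} {s : ℕ → ℕ} (hs : memS n s) (hk : k ≤ n) (h1 : 1 ≤ m) (hm : m < k)
    (hlast : ∀ u, memS n u → (∀ i, k ≤ i → u i = s i) → ¬ corgcLt n s u) :
    (suffixStat n s m % 2 = 0 → s m = 0 ∨ s (m + 1) = s m + 1) ∧
    (suffixStat n s m % 2 = 1 → s m + 1 = m) := by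
  have hle := memS_le hs h1 (by omega)
  have hst := hs.2 m h1 (by omega)
  have key (x : ℕ) (hx : x + 1 ≤ m) (hsx : s (m + 1) ≤ x + 1) :
      ¬ ((suffixStat n s m % 2 = 0 ∧ x < s m) ∨ (suffixStat n s m % 2 = 1 ∧ s m < x)) := by
    intro hlt
    refine hlast (fillWord s m x) (memS_fillWord hs h1 hx fun _ => hsx)
      (fun i hi => fillWord_of_gt (by omega)) ?_
    exact corgcLt_of_suffix h1 (by omega) (fun i hi _ => (fillWord_of_gt hi).symm)
      (by rwa [fillWord_self])
  have hlow := key (s m - 1)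
  have hhigh := key (m - 1)
  omega

/-- A word that is first among the staircase words sharing its suffix from position `k` on. -/
theorem first_value {n k m : ℕ} {t : ℕ → ℕ} (ht : memS n t) (hk : k ≤ n) (h1 : 1 ≤ m) (hm : m < k)
    (hfirst : ∀ u, memS n u → (∀ i, k ≤ i → u i = t i) → ¬ corgcLt n u t) :
    (suffixStat n t m % 2 = 1 → t m = 0 ∨ t (m + 1) = t m + 1) ∧
    (suffixStat n t m % 2 = 0 → t m + 1 = m) := by
  have hle := memS_le ht h1 (by omega)
  have hst := ht.2 m h1 (by omega)
  have key (x : ℕ) (hx : x + 1 ≤ m) (htx : t (m + 1) ≤ x + 1) :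
      ¬ ((suffixStat n t m % 2 = 0 ∧ t m < x) ∨ (suffixStat n t m % 2 = 1 ∧ x < t m)) := by
    intro hlt
    refine hfirst (fillWord t m x) (memS_fillWord ht h1 hx fun _ => htx)
      (fun i hi => fillWord_of_gt (by omega)) ?_
    refine corgcLt_of_suffix h1 (by omega) (fun i hi _ => fillWord_of_gt hi) ?_
    rwa [fillWord_self, suffixStat_congr fun i hi _ => fillWord_of_gt hi]
  have hlow := key (t m - 1)
  have hhigh := key (m - 1)
  omega

/-- With `a`, `b` the values at four consecutive positions `j, …, j + 3` of a last word and a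
first word whose values at `j + 3` are adjacent, both words are maximal at position `j`. -/
theorem eq_max_of_last_of_first {j a₀ a₁ a₂ a₃ b₀ b₁ b₂ b₃ p₀ p₁ p₂ q₀ q₁ q₂ r : ℕ}
    (hadj : a₃ = b₃ + 1 ∨ b₃ = a₃ + 1) (ha : a₀ + 1 ≤ j) (hb : b₀ + 1 ≤ j)
    (ha₀ : a₁ ≤ a₀ + 1) (ha₁ : a₂ ≤ a₁ + 1) (hb₀ : b₁ ≤ b₀ + 1) (hb₁ : b₂ ≤ b₁ + 1)
    (la₀ : (p₀ % 2 = 0 → a₀ = 0 ∨ a₁ = a₀ + 1) ∧ (p₀ % 2 = 1 → a₀ + 1 = j))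
    (la₁ : (p₁ % 2 = 0 → a₁ = 0 ∨ a₂ = a₁ + 1) ∧ (p₁ % 2 = 1 → a₁ + 1 = j + 1))
    (la₂ : (p₂ % 2 = 0 → a₂ = 0 ∨ a₃ = a₂ + 1) ∧ (p₂ % 2 = 1 → a₂ + 1 = j + 2))
    (fb₀ : (q₀ % 2 = 1 → b₀ = 0 ∨ b₁ = b₀ + 1) ∧ (q₀ % 2 = 0 → b₀ + 1 = j))
    (fb₁ : (q₁ % 2 = 1 → b₁ = 0 ∨ b₂ = b₁ + 1) ∧ (q₁ % 2 = 0 → b₁ + 1 = j + 1))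
    (fb₂ : (q₂ % 2 = 1 → b₂ = 0 ∨ b₃ = b₂ + 1) ∧ (q₂ % 2 = 0 → b₂ + 1 = j + 2))
    (hp₀ : p₀ = p₁ + a₁ + 1) (hp₁ : p₁ = p₂ + a₂ + 1) (hp₂ : p₂ = r + a₃ + 1)
    (hq₀ : q₀ = q₁ + b₁ + 1) (hq₁ : q₁ = q₂ + b₂ + 1) (hq₂ : q₂ = r + b₃ + 1) :
    a₀ + 1 = j ∧ b₀ + 1 = j := by
  have hpq : p₂ % 2 + q₂ % 2 = 1 := by
    clear la₀ la₁ la₂ fb₀ fb₁ fb₂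
    omega
  rcases Nat.mod_two_eq_zero_or_one p₂ with h2 | h2
  · have h2' : q₂ % 2 = 1 := by rwa [h2, zero_add] at hpq
    replace la₂ := la₂.1 h2
    replace fb₂ := fb₂.1 h2'
    rcases Nat.mod_two_eq_zero_or_one p₁ with h1 | h1 <;>
    rcases Nat.mod_two_eq_zero_or_one q₁ with h1' | h1' <;>
    rcases Nat.mod_two_eq_zero_or_one p₀ with h0 | h0 <;>
    rcases Nat.mod_two_eq_zero_or_one q₀ with h0' | h0' <;>
    simp only [h1, h1', h0, h0', forall_const, zero_ne_one, one_ne_zero, false_imp_iff,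
      true_and, and_true] at la₀ la₁ fb₀ fb₁ <;>
    omega
  · have := la₂.2 h2
    have := fb₂.2 (by rw [h2] at hpq; exact Nat.add_left_cancel hpq)
    clear la₀ la₁ la₂ fb₀ fb₁ fb₂
    omega

/-- Successive staircase words in the Co-RGC order differ in at
most 3 adjacent positions (3-adjacent Gray code). -/
theorem corgc_staircase_three_adjacent_gray_code
    (n : ℕ) (s t : ℕ → ℕ) (hsucc : IsSuccessor (memS n) (corgcLt n) s t) :
    ∃ k, ∀ i, 1 ≤ i → i ≤ n → i ≠ k → i ≠ k + 1 → i ≠ k + 2 → s i = t i := by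
  obtain ⟨hs, ht, ⟨k, hk1, hkn, heq, hne, hlt⟩, hno⟩ := hsucc
  have hlt' : (suffixStat n s k % 2 = 0 ∧ t k < s k) ∨
      (suffixStat n s k % 2 = 1 ∧ s k < t k) := by
    simp only [Nat.even_iff] at hlt
    unfold suffixStat
    omega
  have hpk := suffixStat_congr heq
  have hlast (u) (hu : memS n u) (hus : ∀ i, k ≤ i → u i = s i) : ¬ corgcLt n s u := by
    refine fun h => hno ⟨u, hu, h, corgcLt_of_suffix hk1 hkn (fun i hi hin => ?_) ?_⟩
    · rw [hus i hi.le, heq i hi hin]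
    · rwa [hus k le_rfl, suffixStat_congr fun i hi _ => hus i (le_of_lt hi)]
  have hfirst (u) (hu : memS n u) (hut : ∀ i, k ≤ i → u i = t i) : ¬ corgcLt n u t := by
    refine fun h => hno ⟨u, hu, corgcLt_of_suffix hk1 hkn (fun i hi hin => ?_) ?_, h⟩
    · rw [hut i hi.le, heq i hi hin]
    · rwa [hut k le_rfl]
  have hsk := memS_le hs hk1 hkn
  have htk := memS_le ht hk1 hkn
  have hbetween (x : ℕ) (hx : x + 1 ≤ k) (hx' : s k < x ∨ t k < x) :
      ¬ ((suffixStat n s k % 2 = 0 ∧ t k < x ∧ x < s k) ∨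
        (suffixStat n s k % 2 = 1 ∧ s k < x ∧ x < t k)) := by
    intro hbt
    refine hno ⟨fillWord s k x, memS_fillWord hs hk1 hx fun hkn' => ?_,
      corgcLt_of_suffix hk1 hkn (fun i hi _ => (fillWord_of_gt hi).symm) ?_,
      corgcLt_of_suffix hk1 hkn (fun i hi hin => (fillWord_of_gt hi).trans (heq i hi hin)) ?_⟩
    · have := hs.2 k hk1 hkn'
      have := ht.2 k hk1 hkn'
      have := heq (k + 1) (by omega) hkn'
      omega
    · rw [fillWord_self]
      omega
    · rw [fillWord_self, suffixStat_congr (w := s) fun i hi _ => fillWord_of_gt hi]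
      omega
  have hadj : s k = t k + 1 ∨ t k = s k + 1 := by
    have := hbetween (s k + 1)
    have := hbetween (t k + 1)
    omega
  refine ⟨k - 2, fun i hi hin h0 h1 h2 => ?_⟩
  rcases lt_or_ge k i with hki | hki
  · exact heq i hki hin
  obtain ⟨j, rfl⟩ : ∃ j, k = j + 3 := ⟨k - 3, by omega⟩
  have hj : 1 ≤ j := by omega
  have hmax : s j + 1 = j ∧ t j + 1 = j := by
    have hsj := memS_le hs hj (by omega)
    have htj := memS_le ht hj (by omega)
    have hs0 := hs.2 j hj (by omega)
    have hs1 := hs.2 (j + 1) (by omega) (by omega)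
    have ht0 := ht.2 j hj (by omega)
    have ht1 := ht.2 (j + 1) (by omega) (by omega)
    have ls0 := last_value hs hkn hj (by omega) hlast
    have ls1 := last_value hs hkn (m := j + 1) (by omega) (by omega) hlast
    have ls2 := last_value hs hkn (m := j + 2) (by omega) (by omega) hlast
    have ft0 := first_value ht hkn hj (by omega) hfirst
    have ft1 := first_value ht hkn (m := j + 1) (by omega) (by omega) hfirst
    have ft2 := first_value ht hkn (m := j + 2) (by omega) (by omega) hfirst
    have ps0 := suffixStat_step s (show j < n by omega)
    have ps1 := suffixStat_step s (show j + 1 < n by omega)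
    have ps2 := suffixStat_step s (show j + 2 < n by omega)
    have pt0 := suffixStat_step t (show j < n by omega)
    have pt1 := suffixStat_step t (show j + 1 < n by omega)
    have pt2 := suffixStat_step t (show j + 2 < n by omega)
    exact eq_max_of_last_of_first hadj hsj htj hs0 hs1 ht0 ht1 ls0 ls1 ls2 ft0 ft1 ft2
      ps0 ps1 ps2 pt0 pt1 (hpk ▸ pt2)
  have hforced {w : ℕ → ℕ} (hw : memS n w) (hwj : w j + 1 = j) : w i + 1 = i := by
    have hij : i ≤ j := by omega
    clear h0 h1 h2 hki hin
    induction hij using Nat.decreasingInduction with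
    | self => exact hwj
    | of_succ i hij ih =>
      have := ih (by omega)
      have := hw.2 i hi (by omega)
      have := memS_le hw hi (by omega)
      omega
  have := hforced hs hmax.1
  have := hforced ht hmax.2
  omega
end
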